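/- Let g ∈ S₀(ℝ) with g ≠ 0 and let Λ ⊆ ℝ² be a lattice such that (g, Λ) is a frame for its closed linear span 𝒢 = 𝒢(g, Λ). If there exists z ∈ ℝ² with z ≠ 0 such that the line L_z = {tz : t ∈ ℝ} satisfies L_z ⊆ 𝔍(𝒢), then 𝒢 = L²(ℝ). -/

import Mathlib

open MeasureTheory Complex Filter
open scoped ENNReal InnerProductSpace RealInnerProductSpace ComplexConjugate

noncomputable section

/-- The Hilbert space `L²(ℝ)` of complex-valued square-integrable functions. -/
abbrev L2 : Type := Lp ℂ 2 (volume : Measure ℝ)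

lemma memLp_translate (a : ℝ) (f : L2) :
    MemLp (fun x : ℝ => f (x - a)) 2 (volume : Measure ℝ) :=
  (Lp.memLp f).comp_measurePreserving (measurePreserving_sub_right volume a)

lemma memLp_modulate (b : ℝ) (f : L2) :
    MemLp (fun x : ℝ => Complex.exp (2 * Real.pi * Complex.I * (b * x)) * f x) 2
      (volume : Measure ℝ) := by
  refine MemLp.of_le (Lp.memLp f) ?_ ?_
  · exact (Complex.continuous_exp.comp (by fun_prop)).aestronglyMeasurable.mul
      (Lp.aestronglyMeasurable f)
  · filter_upwards with x
    have : Complex.exp (2 * Real.pi * Complex.I * (b * x))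
        = Complex.exp ((2 * Real.pi * (b * x) : ℝ) * Complex.I) := by
      push_cast; ring_nf
    rw [norm_mul, this, Complex.norm_exp_ofReal_mul_I, one_mul]

/-- Translation `T_a` on `L²(ℝ)`: `(T_a f)(x) = f (x - a)`. -/
def Tr (a : ℝ) (f : L2) : L2 := (memLp_translate a f).toLp _

/-- Modulation `M_b` on `L²(ℝ)`: `(M_b f)(x) = e^{2πibx} f x`. -/
def Mo (b : ℝ) (f : L2) : L2 := (memLp_modulate b f).toLp _

/-- Time-frequency shift `π(a,b) = T_a M_b`. -/
def tf (z : ℝ × ℝ) (f : L2) : L2 := Tr z.1 (Mo z.2 f)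

/-- The closed linear span `𝒢(g,Λ)` of the Gabor system `(g,Λ)`. -/
def gaborSpan (g : L2) (Λ : Set (ℝ × ℝ)) : Set L2 :=
  closure (Submodule.span ℂ ((fun z => tf z g) '' Λ) : Set L2)

/-- `𝔍(𝒢)`: the set of time-frequency shifts leaving `𝒢` invariant. -/
def stab (G : Set L2) : Set (ℝ × ℝ) := {z | ∀ f ∈ G, tf z f ∈ G}

/-- `Λ` is a lattice in `ℝ²` if `Λ = Aℤ²` for an invertible `2×2` matrix `A`. -/
def IsLattice (Λ : Set (ℝ × ℝ)) : Prop :=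
  ∃ A : Matrix (Fin 2) (Fin 2) ℝ, IsUnit A.det ∧
    Λ = {p : ℝ × ℝ | ∃ k l : ℤ,
      p = (A 0 0 * k + A 0 1 * l, A 1 0 * k + A 1 1 * l)}

lemma memLp_gaussian : MemLp (fun x : ℝ => (Real.exp (-Real.pi * x ^ 2) : ℂ)) 2
    (volume : Measure ℝ) := by
  rw [memLp_two_iff_integrable_sq_norm]
  · have h : Integrable (fun x : ℝ => Real.exp (-(2 * Real.pi) * x ^ 2)) volume :=
      integrable_exp_neg_mul_sq (by positivity)
    refine h.congr (Eventually.of_forall fun x => ?_)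
    simp only [Complex.norm_real, Real.norm_eq_abs, Real.abs_exp, sq, ← Real.exp_add]
    ring_nf
  · exact (Complex.continuous_ofReal.comp (by fun_prop)).aestronglyMeasurable

/-- The Gaussian `φ(x) = e^{-πx²}` as an element of `L²(ℝ)`. -/
def gaussL2 : L2 := memLp_gaussian.toLp _

/-- The Feichtinger algebra condition: `f ∈ S₀(ℝ)` iff `(a,b) ↦ ⟨f, π(a,b)φ⟩ ∈ L¹(ℝ²)`. -/
def InS0 (f : L2) : Prop :=
  Integrable (fun z : ℝ × ℝ => ⟪tf z gaussL2, f⟫_ℂ) (volume : Measure (ℝ × ℝ))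

/-- `(g,Λ)` is a frame for its closed linear span. -/
def IsFrameSeq (g : L2) (Λ : Set (ℝ × ℝ)) : Prop :=
  ∃ A B : ℝ, 0 < A ∧ 0 < B ∧ ∀ f ∈ gaborSpan g Λ,
    A * ‖f‖ ^ 2 ≤ ∑' lam : Λ, ‖⟪tf (lam : ℝ × ℝ) g, f⟫_ℂ‖ ^ 2 ∧
    ∑' lam : Λ, ‖⟪tf (lam : ℝ × ℝ) g, f⟫_ℂ‖ ^ 2 ≤ B * ‖f‖ ^ 2

/-- `(g,Λ)` is a frame for all of `L²(ℝ)`. -/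
def IsFrameL2 (g : L2) (Λ : Set (ℝ × ℝ)) : Prop :=
  ∃ A B : ℝ, 0 < A ∧ 0 < B ∧ ∀ f : L2,
    A * ‖f‖ ^ 2 ≤ ∑' lam : Λ, ‖⟪tf (lam : ℝ × ℝ) g, f⟫_ℂ‖ ^ 2 ∧
    ∑' lam : Λ, ‖⟪tf (lam : ℝ × ℝ) g, f⟫_ℂ‖ ^ 2 ≤ B * ‖f‖ ^ 2

/-- Euclidean ball of radius `ε` around `a ∈ ℝ²`. -/
def eball (ε : ℝ) (a : ℝ × ℝ) : Set (ℝ × ℝ) :=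
  {x : ℝ × ℝ | Real.sqrt ((x.1 - a.1) ^ 2 + (x.2 - a.2) ^ 2) < ε}

/-- `B_ε(Δ) = ⋃_{a ∈ Δ} B_ε(a)`. -/
def eballSet (ε : ℝ) (Δ : Set (ℝ × ℝ)) : Set (ℝ × ℝ) := ⋃ a ∈ Δ, eball ε a

/-- The separable lattice `αℤ × βℤ`. -/
def sepLattice (α β : ℝ) : Set (ℝ × ℝ) :=
  {p : ℝ × ℝ | ∃ k l : ℤ, p = (α * k, β * l)}


/-- The character `t ↦ e^{2πit}`. -/
def ech (t : ℝ) : ℂ := Complex.exp (2 * Real.pi * Complex.I * t)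

lemma ech_eq_exp_mul_I (t : ℝ) : ech t = Complex.exp ((2 * Real.pi * t : ℝ) * Complex.I) := by
  unfold ech; congr 1; push_cast; ring

lemma ech_add (s t : ℝ) : ech (s + t) = ech s * ech t := by
  unfold ech; rw [← Complex.exp_add]; congr 1; push_cast; ring

@[simp] lemma ech_zero : ech 0 = 1 := by simp [ech]

@[simp] lemma norm_ech (t : ℝ) : ‖ech t‖ = 1 := by
  rw [ech_eq_exp_mul_I, Complex.norm_exp_ofReal_mul_I]

lemma ech_mul_ech_neg (t : ℝ) : ech t * ech (-t) = 1 := by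
  rw [← ech_add]; simp

lemma conj_ech (t : ℝ) : conj (ech t) = ech (-t) := by
  rw [ech_eq_exp_mul_I, ech_eq_exp_mul_I, ← Complex.exp_conj]; congr 1; simp [-ofReal_mul]

@[fun_prop] lemma continuous_ech : Continuous ech := by
  unfold ech; fun_prop

lemma Tr_coeFn (a : ℝ) (f : L2) : Tr a f =ᵐ[volume] fun x => f (x - a) :=
  MemLp.coeFn_toLp _

lemma Mo_coeFn (b : ℝ) (f : L2) : Mo b f =ᵐ[volume] fun x => ech (b * x) * f x := by
  refine (MemLp.coeFn_toLp (memLp_modulate b f)).trans (Eventually.of_forall fun x => ?_)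
  simp [ech]

lemma ae_comp_sub {p : ℝ → Prop} (h : ∀ᵐ x, p x) (a : ℝ) : ∀ᵐ x : ℝ, p (x - a) :=
  (measurePreserving_sub_right volume a).quasiMeasurePreserving.ae h

lemma tf_coeFn (w : ℝ × ℝ) (f : L2) :
    tf w f =ᵐ[volume] fun x => ech (w.2 * (x - w.1)) * f (x - w.1) := by
  refine (Tr_coeFn w.1 (Mo w.2 f)).trans ?_
  filter_upwards [ae_comp_sub (Mo_coeFn w.2 f) w.1] with x hx
  exact hx

lemma tf_add (w : ℝ × ℝ) (f h : L2) : tf w (f + h) = tf w f + tf w h := by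
  refine Lp.ext ?_
  filter_upwards [tf_coeFn w (f + h), tf_coeFn w f, tf_coeFn w h, Lp.coeFn_add (tf w f) (tf w h),
    ae_comp_sub (Lp.coeFn_add f h) w.1] with x h1 h2 h3 h4 h5
  rw [h1, h4, Pi.add_apply, h2, h3, h5, Pi.add_apply, mul_add]

lemma tf_smul (w : ℝ × ℝ) (c : ℂ) (f : L2) : tf w (c • f) = c • tf w f := by
  refine Lp.ext ?_
  filter_upwards [tf_coeFn w (c • f), tf_coeFn w f, Lp.coeFn_smul c (tf w f),
    ae_comp_sub (Lp.coeFn_smul c f) w.1] with x h1 h2 h3 h4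
  rw [h1, h3, Pi.smul_apply, h2, h4, Pi.smul_apply, smul_eq_mul, smul_eq_mul]
  ring

lemma norm_Mo (b : ℝ) (f : L2) : ‖Mo b f‖ = ‖f‖ := by
  rw [Lp.norm_def, Lp.norm_def]
  congr 1
  refine eLpNorm_congr_norm_ae ?_
  filter_upwards [Mo_coeFn b f] with x hx
  rw [hx, norm_mul, norm_ech, one_mul]

lemma norm_Tr (a : ℝ) (f : L2) : ‖Tr a f‖ = ‖f‖ := by
  rw [Lp.norm_def, Lp.norm_def, eLpNorm_congr_ae (Tr_coeFn a f)]
  congr 1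
  exact eLpNorm_comp_measurePreserving (Lp.aestronglyMeasurable f)
    (measurePreserving_sub_right volume a)

lemma norm_tf (w : ℝ × ℝ) (f : L2) : ‖tf w f‖ = ‖f‖ := by
  rw [tf, norm_Tr, norm_Mo]

lemma tf_tf (w v : ℝ × ℝ) (f : L2) : tf w (tf v f) = ech (w.2 * v.1) • tf (w + v) f := by
  refine Lp.ext ?_
  filter_upwards [tf_coeFn w (tf v f), tf_coeFn (w + v) f,
    Lp.coeFn_smul (ech (w.2 * v.1)) (tf (w + v) f), ae_comp_sub (tf_coeFn v f) w.1]
    with x h1 h2 h3 h4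
  rw [h1, h3, Pi.smul_apply, h2, h4, smul_eq_mul, ← mul_assoc, ← mul_assoc, ← ech_add, ← ech_add]
  simp only [Prod.fst_add, Prod.snd_add]
  congr 2
  · ring
  · ring

lemma tf_zero (f : L2) : tf 0 f = f := by
  refine Lp.ext ?_
  filter_upwards [tf_coeFn 0 f] with x hx
  rw [hx]; simp

/-- Time-frequency shifts as linear isometries of `L²(ℝ)`. -/
def tfIsometry (w : ℝ × ℝ) : L2 →ₗᵢ[ℂ] L2 where
  toFun := tf w
  map_add' := tf_add w
  map_smul' := tf_smul w
  norm_map' := norm_tf w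

/-- Time-frequency shifts as bounded operators on `L²(ℝ)`. -/
def tfOp (w : ℝ × ℝ) : L2 →L[ℂ] L2 := (tfIsometry w).toContinuousLinearMap

@[simp] lemma tfOp_apply (w : ℝ × ℝ) (f : L2) : tfOp w f = tf w f := rfl

lemma inner_tf_tf (w : ℝ × ℝ) (f h : L2) : ⟪tf w f, tf w h⟫_ℂ = ⟪f, h⟫_ℂ :=
  (tfIsometry w).inner_map_map f h

lemma tfOp_mul (w v : ℝ × ℝ) : tfOp w * tfOp v = ech (w.2 * v.1) • tfOp (w + v) := by
  ext1 f; exact tf_tf w v f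

lemma tfOp_zero : tfOp 0 = 1 := by ext1 f; exact tf_zero f

lemma star_tfOp (w : ℝ × ℝ) : star (tfOp w) = ech (w.2 * w.1) • tfOp (-w) := by
  refine ContinuousLinearMap.ext fun f => ext_inner_left ℂ fun h => ?_
  rw [ContinuousLinearMap.star_eq_adjoint, ContinuousLinearMap.adjoint_inner_right,
    ← inner_tf_tf w h]
  simp only [tfOp_apply, smul_apply, tf_smul, tf_tf]
  simp only [add_neg_cancel, tf_zero, smul_smul, Prod.fst_neg, mul_neg, ech_mul_ech_neg, one_smul]

lemma star_tfOp_mul (w : ℝ × ℝ) : star (tfOp w) * tfOp w = 1 := by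
  rw [star_tfOp, smul_mul_assoc, tfOp_mul, smul_smul, neg_add_cancel, tfOp_zero, Prod.snd_neg,
    neg_mul, ech_mul_ech_neg, one_smul]

lemma tfOp_mul_star (w : ℝ × ℝ) : tfOp w * star (tfOp w) = 1 := by
  rw [star_tfOp, mul_smul_comm, tfOp_mul, smul_smul, add_neg_cancel, tfOp_zero, Prod.fst_neg,
    mul_neg, ech_mul_ech_neg, one_smul]

lemma norm_tfOp_le (w : ℝ × ℝ) : ‖tfOp w‖ ≤ 1 :=
  (tfIsometry w).norm_toContinuousLinearMap_le

/-- Conjugation of a bounded operator by a time-frequency shift. -/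
def conjTf (w : ℝ × ℝ) (X : L2 →L[ℂ] L2) : L2 →L[ℂ] L2 := tfOp w * X * star (tfOp w)

lemma conjTf_add (w v : ℝ × ℝ) (X : L2 →L[ℂ] L2) :
    conjTf (w + v) X = conjTf w (conjTf v X) := by
  have h : tfOp (w + v) = ech (-(w.2 * v.1)) • (tfOp w * tfOp v) := by
    rw [tfOp_mul, smul_smul, mul_comm, ech_mul_ech_neg, one_smul]
  simp only [conjTf, h, star_smul, star_mul, smul_mul_assoc, mul_smul_comm, smul_smul]
  have : star (ech (-(w.2 * v.1))) * ech (-(w.2 * v.1)) = 1 := by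
    rw [← starRingEnd_apply, conj_ech, neg_neg, ech_mul_ech_neg]
  rw [this, one_smul]
  simp only [mul_assoc]

lemma conjTf_mul (w : ℝ × ℝ) (X Y : L2 →L[ℂ] L2) :
    conjTf w (X * Y) = conjTf w X * conjTf w Y := by
  calc conjTf w (X * Y) = tfOp w * X * 1 * Y * star (tfOp w) := by simp [conjTf, mul_assoc]
    _ = _ := by rw [← star_tfOp_mul w]; simp only [conjTf, mul_assoc]

lemma conjTf_sub (w : ℝ × ℝ) (X Y : L2 →L[ℂ] L2) :
    conjTf w (X - Y) = conjTf w X - conjTf w Y := by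
  simp [conjTf, mul_sub, sub_mul]

lemma conjTf_smul (w : ℝ × ℝ) (c : ℂ) (X : L2 →L[ℂ] L2) :
    conjTf w (c • X) = c • conjTf w X := by
  simp [conjTf]

lemma conjTf_eq_self_iff (w : ℝ × ℝ) (X : L2 →L[ℂ] L2) :
    conjTf w X = X ↔ tfOp w * X = X * tfOp w := by
  constructor
  · intro h
    calc tfOp w * X = tfOp w * X * (star (tfOp w) * tfOp w) := by rw [star_tfOp_mul, mul_one]
      _ = conjTf w X * tfOp w := by simp only [conjTf, mul_assoc]
      _ = _ := by rw [h]
  · intro h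
    rw [conjTf, h, mul_assoc, tfOp_mul_star, mul_one]

lemma norm_conjTf_le (w : ℝ × ℝ) (X : L2 →L[ℂ] L2) : ‖conjTf w X‖ ≤ ‖X‖ := by
  calc ‖conjTf w X‖ ≤ ‖tfOp w‖ * ‖X‖ * ‖star (tfOp w)‖ :=
        (norm_mul_le _ _).trans (by gcongr; exact norm_mul_le _ _)
    _ ≤ 1 * ‖X‖ * 1 := by
        gcongr
        · exact norm_tfOp_le w
        · rw [star_tfOp, norm_smul, norm_ech, one_mul]; exact norm_tfOp_le _
    _ = ‖X‖ := by ring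

lemma conjTf_tfOp (w v : ℝ × ℝ) :
    conjTf w (tfOp v) = ech (w.2 * v.1 - v.2 * w.1) • tfOp v := by
  have h : tfOp w * tfOp v = ech (w.2 * v.1 - v.2 * w.1) • (tfOp v * tfOp w) := by
    rw [tfOp_mul, tfOp_mul, smul_smul, ← ech_add, sub_add_cancel, add_comm w v]
  rw [conjTf, h, smul_mul_assoc, mul_assoc, tfOp_mul_star, mul_one]

open scoped FourierTransform SchwartzMap in
/-- On `L¹ ∩ L²` the `L²` Fourier transform is given by the Fourier integral. -/
lemma fourier_toLp_ae {u : ℝ → ℂ} (h1 : Integrable u) (h2 : MemLp u 2 volume) :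
    (𝓕 (h2.toLp u) : Lp (α := ℝ) ℂ 2 volume) =ᵐ[volume] 𝓕 u := by
  have hcont : Continuous (𝓕 u) :=
    VectorFourier.fourierIntegral_continuous Real.continuous_fourierChar
      (by exact continuous_inner) h1
  refine ae_eq_of_integral_contDiff_smul_eq
    ((Lp.memLp _).locallyIntegrable one_le_two) hcont.locallyIntegrable ?_
  intro ψ hψ hψc
  let ψ' : 𝓢(ℝ, ℂ) := HasCompactSupport.toSchwartzMap (f := fun x => (ψ x : ℂ))
    (hψc.comp_left Complex.ofReal_zero) (Complex.ofRealCLM.contDiff.comp hψ)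
  have hψ' : ∀ x, ψ' x = (ψ x : ℂ) := fun x => rfl
  have key := congrArg (fun T : 𝓢'(ℝ, ℂ) => T ψ')
    (Lp.fourier_toTemperedDistribution_eq (h2.toLp u))
  simp only [TemperedDistribution.fourier_apply, Lp.toTemperedDistribution_apply] at key
  have e1 : ∫ x, ψ x • (𝓕 (h2.toLp u) : Lp (α := ℝ) ℂ 2 volume) x
      = ∫ x, ψ' x • (𝓕 (h2.toLp u) : Lp (α := ℝ) ℂ 2 volume) x := by
    simp [hψ']
  have e2 : ∫ x, ψ x • 𝓕 u x = ∫ x, ψ' x • 𝓕 u x := by simp [hψ']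
  rw [e1, e2, ← key]
  have e3 := VectorFourier.integral_fourierIntegral_smul_eq_flip (μ := volume) (ν := volume)
    (L := innerₗ ℝ) (e := Real.fourierChar) (f := ψ') (g := u) Real.continuous_fourierChar
    (by exact continuous_inner) ψ'.integrable h1
  rw [flip_innerₗ] at e3
  refine Eq.trans ?_ e3
  refine integral_congr_ae ?_
  filter_upwards [h2.coeFn_toLp] with x hx
  rw [hx, SchwartzMap.fourier_coe]
  rfl

lemma continuous_Tr (f : L2) : Continuous fun a : ℝ => Tr a f := by
  have h : ∀ a : ℝ, Tr a f = DomAddAct.mk (-a) +ᵥ f := by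
    intro a
    refine Lp.ext ?_
    filter_upwards [Tr_coeFn a f, DomAddAct.vadd_Lp_ae_eq (DomAddAct.mk (-a)) f] with x h1 h2
    rw [h1, h2]
    simp [sub_eq_neg_add]
  simp_rw [h]
  have hc : Continuous fun a : ℝ => DomAddAct.mk (-a) :=
    DomAddAct.continuous_mk.comp continuous_neg
  have : Fact ((2 : ℝ≥0∞) ≠ ∞) := ⟨by simp⟩
  exact hc.vadd continuous_const

lemma Tr_sub (a : ℝ) (f h : L2) : Tr a (f - h) = Tr a f - Tr a h := by
  refine Lp.ext ?_
  filter_upwards [Tr_coeFn a (f - h), Tr_coeFn a f, Tr_coeFn a h, Lp.coeFn_sub (Tr a f) (Tr a h),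
    ae_comp_sub (Lp.coeFn_sub f h) a] with x h1 h2 h3 h4 h5
  rw [h1, h4, Pi.sub_apply, h2, h3, h5, Pi.sub_apply]

lemma inner_Mo_Mo (b c : ℝ) (f : L2) :
    ⟪Mo b f, Mo c f⟫_ℂ = ∫ x, ech ((c - b) * x) * ((‖f x‖ ^ 2 : ℝ) : ℂ) := by
  rw [L2.inner_def]
  refine integral_congr_ae ?_
  filter_upwards [Mo_coeFn b f, Mo_coeFn c f] with x h1 h2
  rw [h1, h2, RCLike.inner_apply, map_mul, conj_ech, sub_mul, sub_eq_add_neg, ech_add,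
    Complex.ofReal_pow, ← Complex.mul_conj']
  ring

lemma integrable_norm_sq (f : L2) : Integrable (fun x => ‖f x‖ ^ 2) :=
  (memLp_two_iff_integrable_sq_norm (Lp.aestronglyMeasurable f)).1 (Lp.memLp f)

lemma continuous_Mo (f : L2) : Continuous fun b : ℝ => Mo b f := by
  rw [continuous_iff_continuousAt]
  intro c
  rw [ContinuousAt, tendsto_iff_norm_sub_tendsto_zero]
  have hc : Continuous fun b : ℝ => ⟪Mo b f, Mo c f⟫_ℂ := by
    simp_rw [inner_Mo_Mo]
    refine continuous_of_dominated (bound := fun x => ‖f x‖ ^ 2) ?_ ?_ (integrable_norm_sq f) ?_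
    · intro b
      refine (Continuous.aestronglyMeasurable (by fun_prop)).mul ?_
      exact Complex.continuous_ofReal.comp_aestronglyMeasurable
        (integrable_norm_sq f).aestronglyMeasurable
    · intro b
      filter_upwards with x
      rw [norm_mul, norm_ech, one_mul, Complex.norm_real, Real.norm_of_nonneg (by positivity)]
    · filter_upwards with x
      fun_prop
  have hsq : Tendsto (fun b => ‖Mo b f - Mo c f‖ ^ 2) (nhds c) (nhds 0) := by
    have h : ∀ b, ‖Mo b f - Mo c f‖ ^ 2 = 2 * ‖f‖ ^ 2 - 2 * (⟪Mo b f, Mo c f⟫_ℂ).re := by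
      intro b
      rw [@norm_sub_sq ℂ, norm_Mo, norm_Mo]
      simp only [RCLike.re_to_complex]
      ring
    have h0 : 2 * ‖f‖ ^ 2 - 2 * (⟪Mo c f, Mo c f⟫_ℂ).re = 0 := by rw [← h]; simp
    simp_rw [h]
    rw [← h0]
    exact (continuous_const.sub (continuous_const.mul
      (Complex.continuous_re.comp hc))).tendsto c
  have := hsq.sqrt
  simpa using this

lemma continuous_tf (f : L2) : Continuous fun w : ℝ × ℝ => tf w f := by
  rw [continuous_iff_continuousAt]
  rintro ⟨a, b⟩
  rw [ContinuousAt, tendsto_iff_norm_sub_tendsto_zero]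
  have h1 : Tendsto (fun w : ℝ × ℝ => ‖Mo w.2 f - Mo b f‖ + ‖Tr w.1 (Mo b f) - Tr a (Mo b f)‖)
      (nhds (a, b)) (nhds 0) := by
    have : Continuous (fun w : ℝ × ℝ => ‖Mo w.2 f - Mo b f‖ + ‖Tr w.1 (Mo b f) - Tr a (Mo b f)‖) :=
      ((((continuous_Mo f).comp continuous_snd).sub continuous_const).norm).add
        ((((continuous_Tr (Mo b f)).comp continuous_fst).sub continuous_const).norm)
    simpa using this.tendsto (a, b)
  refine squeeze_zero (fun _ => norm_nonneg _) (fun w => ?_) h1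
  have : tf w f - tf (a, b) f = Tr w.1 (Mo w.2 f - Mo b f) + (Tr w.1 (Mo b f) - Tr a (Mo b f)) := by
    rw [Tr_sub, tf, tf]; abel
  rw [this]
  refine (norm_add_le _ _).trans ?_
  rw [norm_Tr]

/-- The product whose Fourier transform is the short-time Fourier transform at time `a`. -/
def stftProd (f k : L2) (a x : ℝ) : ℂ := f x * conj (k (x - a))

lemma memLp_conj_sub (k : L2) (a : ℝ) : MemLp (fun x : ℝ => conj (k (x - a))) 2 volume :=
  (memLp_translate a k).star

lemma integrable_stftProd (f k : L2) (a : ℝ) : Integrable (stftProd f k a) :=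
  (Lp.memLp f).integrable_mul (memLp_conj_sub k a)

open scoped FourierTransform in
lemma inner_tf_left_eq (f k : L2) (a b : ℝ) :
    ⟪tf (a, b) k, f⟫_ℂ = ech (a * b) * 𝓕 (stftProd f k a) b := by
  rw [L2.inner_def, Real.fourier_real_eq_integral_exp_smul, ← integral_const_mul]
  refine integral_congr_ae ?_
  filter_upwards [tf_coeFn (a, b) k] with x hx
  rw [hx, RCLike.inner_apply, map_mul, conj_ech, stftProd, smul_eq_mul]
  have : Complex.exp ((-2 * Real.pi * x * b : ℝ) * Complex.I) = ech (-(x * b)) := by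
    rw [ech_eq_exp_mul_I]; congr 2; push_cast; ring
  rw [this]
  have : ech (-(b * (x - a))) = ech (a * b) * ech (-(x * b)) := by
    rw [← ech_add]; congr 1; ring
  simp only [this]
  ring

lemma integrable_mul_comp_sub {F G : ℝ → ℂ} (hF : Integrable F) (hG : Integrable G) :
    Integrable (fun p : ℝ × ℝ => F p.2 * G (p.2 - p.1)) (volume.prod volume) := by
  have h := (hF.mul_prod hG)
  have hmp : MeasurePreserving (fun p : ℝ × ℝ => (p.2, p.2 - p.1)) (volume.prod volume)
      (volume.prod volume) := by
    have h1 : MeasurePreserving (fun p : ℝ × ℝ => (p.1, p.1 - p.2)) (volume.prod volume)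
        (volume.prod volume) :=
      (MeasurePreserving.id volume).skew_product (g := fun x y : ℝ => x - y)
        (by fun_prop) (Eventually.of_forall fun x => (Measure.measurePreserving_sub_left volume x).map_eq)
    exact h1.comp Measure.measurePreserving_swap
  exact hmp.integrable_comp_of_integrable h

lemma integral_integral_mul_comp_sub {F G : ℝ → ℂ} (hF : Integrable F) (hG : Integrable G) :
    ∫ a, ∫ x, F x * G (x - a) = (∫ x, F x) * ∫ x, G x := by
  rw [integral_integral_swap (integrable_mul_comp_sub hF hG)]
  simp_rw [integral_const_mul, integral_sub_left_eq_self (fun y => G y)]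
  rw [integral_mul_const]

lemma integrable_mul_conj (f h : L2) : Integrable (fun x => f x * conj (h x)) :=
  (Lp.memLp f).integrable_mul (Lp.memLp h).star

lemma integrable_stftProd_mul_conj (f h k l : L2) :
    Integrable (fun p : ℝ × ℝ => stftProd f k p.1 p.2 * conj (stftProd h l p.1 p.2))
      (volume.prod volume) := by
  refine (integrable_mul_comp_sub (integrable_mul_conj f h)
    (integrable_mul_conj l k)).congr (Eventually.of_forall fun p => ?_)
  simp only [stftProd, map_mul, Complex.conj_conj]
  ring

lemma ae_memLp_stftProd (f k : L2) : ∀ᵐ a, MemLp (stftProd f k a) 2 volume := by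
  filter_upwards [(integrable_stftProd_mul_conj f f k k).prod_right_ae] with a ha
  rw [memLp_two_iff_integrable_sq_norm (integrable_stftProd f k a).aestronglyMeasurable]
  refine ha.norm.congr (Eventually.of_forall fun x => ?_)
  simp [sq]

lemma continuous_inner_tf (f k : L2) : Continuous fun w : ℝ × ℝ => ⟪tf w k, f⟫_ℂ :=
  (continuous_tf k).inner continuous_const

open scoped FourierTransform in
lemma integrable_and_integral_stft_slice (f h k l : L2) {a : ℝ}
    (h1 : MemLp (stftProd f k a) 2 volume) (h2 : MemLp (stftProd h l a) 2 volume) :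
    Integrable (fun b => ⟪tf (a, b) k, f⟫_ℂ * ⟪h, tf (a, b) l⟫_ℂ) ∧
    ∫ b, ⟪tf (a, b) k, f⟫_ℂ * ⟪h, tf (a, b) l⟫_ℂ
      = ∫ x, stftProd f k a x * conj (stftProd h l a x) := by
  have e1 := fourier_toLp_ae (integrable_stftProd f k a) h1
  have e2 := fourier_toLp_ae (integrable_stftProd h l a) h2
  have e : (fun b => ⟪tf (a, b) k, f⟫_ℂ * ⟪h, tf (a, b) l⟫_ℂ) =ᵐ[volume] fun b =>
      ⟪(𝓕 (h2.toLp _) : Lp (α := ℝ) ℂ 2 volume) b,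
        (𝓕 (h1.toLp _) : Lp (α := ℝ) ℂ 2 volume) b⟫_ℂ := by
    filter_upwards [e1, e2] with b hb1 hb2
    rw [hb1, hb2, ← inner_conj_symm h, inner_tf_left_eq, inner_tf_left_eq, RCLike.inner_apply,
      map_mul, conj_ech]
    linear_combination (𝓕 (stftProd f k a) b * conj (𝓕 (stftProd h l a) b)) *
      ech_mul_ech_neg (a * b)
  refine ⟨(L2.integrable_inner _ _).congr e.symm, ?_⟩
  rw [integral_congr_ae e, ← L2.inner_def, Lp.inner_fourier_eq, L2.inner_def]
  refine integral_congr_ae ?_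
  filter_upwards [h1.coeFn_toLp, h2.coeFn_toLp] with x hx1 hx2
  rw [hx1, hx2, RCLike.inner_apply]

lemma memLp_inner_tf (f k : L2) : MemLp (fun w : ℝ × ℝ => ⟪tf w k, f⟫_ℂ) 2 volume := by
  rw [memLp_two_iff_integrable_sq_norm (continuous_inner_tf f k).aestronglyMeasurable,
    Measure.volume_eq_prod, integrable_prod_iff (by
      exact ((continuous_inner_tf f k).norm.pow 2).aestronglyMeasurable)]
  have key : ∀ (w : ℝ × ℝ), ((‖⟪tf w k, f⟫_ℂ‖ ^ 2 : ℝ) : ℂ) = ⟪tf w k, f⟫_ℂ * ⟪f, tf w k⟫_ℂ := by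
    intro w
    rw [← inner_conj_symm f, Complex.mul_conj']
    push_cast; rfl
  constructor
  · filter_upwards [ae_memLp_stftProd f k] with a ha
    refine ((integrable_and_integral_stft_slice f f k k ha ha).1.norm).congr
      (Eventually.of_forall fun b => ?_)
    simp only [norm_mul, norm_inner_symm f, sq]
  · refine ((integrable_stftProd_mul_conj f f k k).integral_prod_left.norm).congr ?_
    filter_upwards [ae_memLp_stftProd f k] with a ha
    rw [← (integrable_and_integral_stft_slice f f k k ha ha).2]
    simp_rw [← key]
    rw [integral_complex_ofReal, Complex.norm_real,
      Real.norm_of_nonneg (integral_nonneg fun _ => by positivity)]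
    simp

lemma integrable_inner_tf_mul (f h k l : L2) :
    Integrable (fun w : ℝ × ℝ => ⟪tf w k, f⟫_ℂ * ⟪h, tf w l⟫_ℂ) := by
  refine (memLp_inner_tf f k).integrable_mul ((memLp_inner_tf h l).star.congr_norm ?_ ?_)
  · exact (continuous_const.inner (continuous_tf l)).aestronglyMeasurable
  · refine Eventually.of_forall fun w => ?_
    simp [norm_inner_symm h]

/-- The orthogonality relations for the short-time Fourier transform. -/
lemma integral_inner_tf_mul (f h k l : L2) :
    ∫ w : ℝ × ℝ, ⟪tf w k, f⟫_ℂ * ⟪h, tf w l⟫_ℂ = ⟪h, f⟫_ℂ * ⟪k, l⟫_ℂ := by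
  have hi := integrable_inner_tf_mul f h k l
  rw [Measure.volume_eq_prod] at hi ⊢
  rw [integral_prod _ hi, L2.inner_def, L2.inner_def]
  simp_rw [RCLike.inner_apply]
  rw [← integral_integral_mul_comp_sub (integrable_mul_conj f h) (integrable_mul_conj l k)]
  refine integral_congr_ae ?_
  filter_upwards [ae_memLp_stftProd f k, ae_memLp_stftProd h l] with a h1 h2
  rw [(integrable_and_integral_stft_slice f h k l h1 h2).2]
  refine integral_congr_ae (Eventually.of_forall fun x => ?_)
  simp only [stftProd, map_mul, Complex.conj_conj]
  ring

/-- An operator commuting with all time-frequency shifts is a multiple of the identity. -/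
lemma exists_smul_of_commute_tfOp {X : L2 →L[ℂ] L2}
    (hX : ∀ w, tfOp w * X = X * tfOp w) : ∃ c : ℂ, X = c • 1 := by
  by_cases hk : ∃ k : L2, k ≠ 0
  swap
  · push Not at hk
    refine ⟨0, ContinuousLinearMap.ext fun f => ?_⟩
    rw [hk (X f), hk ((0 • (1 : L2 →L[ℂ] L2)) f)]
  obtain ⟨k, hk⟩ := hk
  have hkk : ⟪k, k⟫_ℂ ≠ 0 := inner_self_ne_zero.2 hk
  have hX' : ∀ w h, tf w (X h) = X (tf w h) := fun w h => congrArg (fun Y => Y h) (hX w)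
  refine ⟨⟪k, X k⟫_ℂ / ⟪k, k⟫_ℂ, ContinuousLinearMap.ext fun f => ext_inner_left ℂ fun h => ?_⟩
  have h1 := integral_inner_tf_mul f h k (X k)
  have h2 := integral_inner_tf_mul f (ContinuousLinearMap.adjoint X h) k k
  simp_rw [ContinuousLinearMap.adjoint_inner_left, ← hX'] at h2
  rw [h1] at h2
  rw [smul_apply, inner_smul_right, one_apply_eq_self]
  field_simp
  linear_combination -h2

lemma gaussL2_coeFn : gaussL2 =ᵐ[volume] fun x : ℝ => ((Real.exp (-Real.pi * x ^ 2) : ℝ) : ℂ) :=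
  (MemLp.coeFn_toLp memLp_gaussian).trans (Eventually.of_forall fun x => by simp)

lemma norm_inner_tf_gaussL2_le (w : ℝ × ℝ) :
    ‖⟪tf w gaussL2, gaussL2⟫_ℂ‖ ≤ Real.exp (-(Real.pi / 2) * (w.1 ^ 2 + w.2 ^ 2)) := by
  obtain ⟨a, b⟩ := w
  have h : ⟪tf (a, b) gaussL2, gaussL2⟫_ℂ = ∫ x : ℝ, Complex.exp ((-2 * Real.pi : ℂ) * x ^ 2
      + (2 * Real.pi * (a - Complex.I * b)) * x
      + (-Real.pi * a ^ 2 + 2 * Real.pi * Complex.I * a * b)) := by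
    rw [L2.inner_def]
    refine integral_congr_ae ?_
    filter_upwards [tf_coeFn (a, b) gaussL2, gaussL2_coeFn, ae_comp_sub gaussL2_coeFn a]
      with x h1 h2 h3
    rw [h1, h2, RCLike.inner_apply, h3, map_mul, conj_ech, Complex.conj_ofReal, ech,
      Complex.ofReal_exp, Complex.ofReal_exp, ← Complex.exp_add, ← Complex.exp_add]
    congr 1
    push_cast
    ring
  have hb : (-2 * Real.pi : ℂ).re < 0 := by
    have : (-2 * Real.pi : ℂ) = ((-2 * Real.pi : ℝ) : ℂ) := by push_cast; ring
    rw [this, Complex.ofReal_re]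
    have := Real.pi_pos
    linarith
  have hpi : (Real.pi : ℂ) ≠ 0 := Complex.ofReal_ne_zero.2 Real.pi_ne_zero
  rw [h, integral_cexp_quadratic hb, norm_mul]
  have h1 : (Real.pi : ℂ) / -(-2 * Real.pi) = ((1 / 2 : ℝ) : ℂ) := by
    push_cast; field_simp
  have h2 : (-Real.pi * a ^ 2 + 2 * Real.pi * Complex.I * a * b : ℂ)
      - (2 * Real.pi * (a - Complex.I * b)) ^ 2 / (4 * (-2 * Real.pi))
      = ((-(Real.pi / 2) * (a ^ 2 + b ^ 2) : ℝ) : ℂ) + (Real.pi * a * b : ℝ) * Complex.I := by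
    push_cast
    field_simp
    ring_nf
    simp only [Complex.I_sq]
    ring
  rw [h1, h2, Complex.norm_exp]
  have h3 : ‖(((1 / 2 : ℝ) : ℂ)) ^ (1 / 2 : ℂ)‖ ≤ 1 := by
    rw [Complex.norm_cpow_eq_rpow_re_of_pos (by norm_num)]
    exact Real.rpow_le_one (by norm_num) (by norm_num) (by norm_num)
  have h4 : (((-(Real.pi / 2) * (a ^ 2 + b ^ 2) : ℝ) : ℂ)
      + (Real.pi * a * b : ℝ) * Complex.I).re = -(Real.pi / 2) * (a ^ 2 + b ^ 2) := by
    rw [Complex.add_re, Complex.re_ofReal_mul, Complex.I_re, Complex.ofReal_re, mul_zero, add_zero]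
  rw [h4]
  exact mul_le_of_le_one_left (Real.exp_pos _).le h3

lemma summable_exp_neg_mul_int_sq {c : ℝ} (hc : 0 < c) :
    Summable fun k : ℤ => Real.exp (-c * (k : ℝ) ^ 2) := by
  have h := (summable_pow_mul_jacobiTheta₂_term_bound 0 (T := c / Real.pi) (by positivity) 0)
  refine h.congr fun k => ?_
  simp only [pow_zero, one_mul]
  congr 1
  field_simp
  ring

/-- The parametrisation of the lattice `Aℤ²`. -/
def latticeHom (A : Matrix (Fin 2) (Fin 2) ℝ) : ℤ × ℤ →+ ℝ × ℝ where
  toFun p := (A 0 0 * p.1 + A 0 1 * p.2, A 1 0 * p.1 + A 1 1 * p.2)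
  map_zero' := by simp
  map_add' p q := by
    ext <;> simp <;> ring

lemma det_sq_mul_le (A : Matrix (Fin 2) (Fin 2) ℝ) (p : ℤ × ℤ) :
    A.det ^ 2 * ((p.1 : ℝ) ^ 2 + (p.2 : ℝ) ^ 2) ≤
      (A 0 0 ^ 2 + A 0 1 ^ 2 + A 1 0 ^ 2 + A 1 1 ^ 2) *
        ((latticeHom A p).1 ^ 2 + (latticeHom A p).2 ^ 2) := by
  simp only [latticeHom, AddMonoidHom.coe_mk, ZeroHom.coe_mk, Matrix.det_fin_two]
  generalize (p.1 : ℝ) = k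
  generalize (p.2 : ℝ) = l
  set x := A 0 0 * k + A 0 1 * l with hx
  set y := A 1 0 * k + A 1 1 * l with hy
  have h1 : (A 0 0 * A 1 1 - A 0 1 * A 1 0) * k = A 1 1 * x - A 0 1 * y := by rw [hx, hy]; ring
  have h2 : (A 0 0 * A 1 1 - A 0 1 * A 1 0) * l = A 0 0 * y - A 1 0 * x := by rw [hx, hy]; ring
  rw [mul_add, ← mul_pow, ← mul_pow, h1, h2]
  nlinarith [sq_nonneg (A 1 1 * y + A 0 1 * x), sq_nonneg (A 0 0 * x + A 1 0 * y)]

lemma latticeHom_injective {A : Matrix (Fin 2) (Fin 2) ℝ} (hA : A.det ≠ 0) :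
    Function.Injective (latticeHom A) := by
  rw [injective_iff_map_eq_zero]
  intro p hp
  have h := det_sq_mul_le A p
  rw [hp] at h
  simp only [Prod.fst_zero, Prod.snd_zero] at h
  have hd : 0 < A.det ^ 2 := by positivity
  have h0 : (p.1 : ℝ) ^ 2 + (p.2 : ℝ) ^ 2 ≤ 0 := by nlinarith
  have h1 : (p.1 : ℝ) = 0 := by nlinarith [sq_nonneg (p.1 : ℝ), sq_nonneg (p.2 : ℝ)]
  have h2 : (p.2 : ℝ) = 0 := by nlinarith [sq_nonneg (p.1 : ℝ), sq_nonneg (p.2 : ℝ)]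
  exact Prod.ext (by exact_mod_cast h1) (by exact_mod_cast h2)

lemma summable_gaussian_latticeHom {A : Matrix (Fin 2) (Fin 2) ℝ} (hA : A.det ≠ 0) :
    Summable fun p : ℤ × ℤ => Real.exp (-(Real.pi / 2) *
      ((latticeHom A p).1 ^ 2 + (latticeHom A p).2 ^ 2)) := by
  set M := A 0 0 ^ 2 + A 0 1 ^ 2 + A 1 0 ^ 2 + A 1 1 ^ 2 with hM
  have hd : 0 < A.det ^ 2 := by positivity
  have hMpos : 0 < M := by
    have h := det_sq_mul_le A (1, 0)
    rw [← hM] at h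
    by_contra hneg
    have hM0 : M = 0 := le_antisymm (not_lt.1 hneg) (by rw [hM]; positivity)
    rw [hM0] at h
    norm_num at h
    exact absurd h (by positivity)
  have hc : 0 < Real.pi / 2 * (A.det ^ 2 / M) := by positivity
  have hs := (summable_exp_neg_mul_int_sq hc).mul_of_nonneg (summable_exp_neg_mul_int_sq hc)
    (fun _ => (Real.exp_pos _).le) (fun _ => (Real.exp_pos _).le)
  refine hs.of_nonneg_of_le (fun _ => (Real.exp_pos _).le) fun p => ?_
  rw [← Real.exp_add, Real.exp_le_exp]
  have h := det_sq_mul_le A p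
  rw [← hM] at h
  have h' : A.det ^ 2 / M * ((p.1 : ℝ) ^ 2 + (p.2 : ℝ) ^ 2) ≤
      (latticeHom A p).1 ^ 2 + (latticeHom A p).2 ^ 2 := by
    rw [div_mul_eq_mul_div, div_le_iff₀ hMpos]; linarith
  nlinarith [Real.pi_pos]

/-- Schur's test for the Gram matrix of a family of vectors. -/
lemma norm_sum_smul_sq_le {ι H : Type*} [NormedAddCommGroup H] [InnerProductSpace ℂ H]
    (s : Finset ι) (v : ι → H) {K : ℝ}
    (hK : ∀ p, ∑ q ∈ s, ‖⟪v p, v q⟫_ℂ‖ ≤ K) (d : ι → ℂ) :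
    ‖∑ p ∈ s, d p • v p‖ ^ 2 ≤ K * ∑ p ∈ s, ‖d p‖ ^ 2 := by
  have h1 : ‖∑ p ∈ s, d p • v p‖ ^ 2 ≤ ∑ p ∈ s, ∑ q ∈ s, ‖d p‖ * ‖d q‖ * ‖⟪v p, v q⟫_ℂ‖ := by
    calc ‖∑ p ∈ s, d p • v p‖ ^ 2
        = ‖⟪∑ p ∈ s, d p • v p, ∑ p ∈ s, d p • v p⟫_ℂ‖ := by
          rw [inner_self_eq_norm_sq_to_K]; simp
      _ = ‖∑ p ∈ s, ∑ q ∈ s, conj (d p) * (d q * ⟪v p, v q⟫_ℂ)‖ := by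
          simp_rw [sum_inner, inner_sum, inner_smul_left, inner_smul_right]
      _ ≤ _ := by
          refine (norm_sum_le _ _).trans (Finset.sum_le_sum fun p _ => ?_)
          refine (norm_sum_le _ _).trans (Finset.sum_le_sum fun q _ => ?_)
          rw [norm_mul, norm_mul, RCLike.norm_conj, mul_assoc]
  refine h1.trans ?_
  have h2 : ∑ p ∈ s, ∑ q ∈ s, ‖d p‖ * ‖d q‖ * ‖⟪v p, v q⟫_ℂ‖ ≤
      ∑ p ∈ s, ∑ q ∈ s, (‖d p‖ ^ 2 / 2 * ‖⟪v p, v q⟫_ℂ‖ + ‖d q‖ ^ 2 / 2 * ‖⟪v q, v p⟫_ℂ‖) := by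
    refine Finset.sum_le_sum fun p _ => Finset.sum_le_sum fun q _ => ?_
    rw [norm_inner_symm (v q), ← add_mul]
    gcongr
    nlinarith [sq_nonneg (‖d p‖ - ‖d q‖)]
  have h3 : ∑ p ∈ s, ∑ q ∈ s, ‖d p‖ ^ 2 / 2 * ‖⟪v p, v q⟫_ℂ‖ ≤ K / 2 * ∑ p ∈ s, ‖d p‖ ^ 2 := by
    rw [Finset.mul_sum]
    refine Finset.sum_le_sum fun p _ => ?_
    rw [← Finset.mul_sum]
    nlinarith [hK p, sq_nonneg ‖d p‖]
  refine h2.trans ?_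
  simp_rw [Finset.sum_add_distrib]
  rw [Finset.sum_comm (f := fun p q => ‖d q‖ ^ 2 / 2 * ‖⟪v q, v p⟫_ℂ‖)]
  linarith

lemma norm_inner_tf_tf (w v : ℝ × ℝ) (f h : L2) :
    ‖⟪tf w f, tf v h⟫_ℂ‖ = ‖⟪tf (w - v) f, h⟫_ℂ‖ := by
  have h1 : tf v (tf (w - v) f) = ech (v.2 * (w - v).1) • tf w f := by
    rw [tf_tf, add_sub_cancel]
  rw [← inner_tf_tf v (tf (w - v) f), h1, inner_smul_left, norm_mul, RCLike.norm_conj, norm_ech,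
    one_mul]

/-- Gabor systems of the Gaussian over a lattice are Bessel sequences. -/
lemma exists_bessel_gaussL2 {A : Matrix (Fin 2) (Fin 2) ℝ} (hA : A.det ≠ 0) :
    ∃ K : ℝ, 0 ≤ K ∧ ∀ (s : Finset (ℤ × ℤ)) (d : ℤ × ℤ → ℂ),
      ‖∑ p ∈ s, d p • tf (latticeHom A p) gaussL2‖ ≤ K * √(∑ p ∈ s, ‖d p‖ ^ 2) := by
  set G : ℤ × ℤ → ℝ := fun p => Real.exp (-(Real.pi / 2) *
      ((latticeHom A p).1 ^ 2 + (latticeHom A p).2 ^ 2)) with hG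
  have hsum : Summable G := summable_gaussian_latticeHom hA
  have hG0 : ∀ p, 0 ≤ G p := fun p => (Real.exp_pos _).le
  refine ⟨√(∑' p, G p), Real.sqrt_nonneg _, fun s d => ?_⟩
  rw [← Real.sqrt_mul (tsum_nonneg hG0)]
  refine Real.le_sqrt_of_sq_le (norm_sum_smul_sq_le s _ (fun p => ?_) d)
  calc ∑ q ∈ s, ‖⟪tf (latticeHom A p) gaussL2, tf (latticeHom A q) gaussL2⟫_ℂ‖
      ≤ ∑ q ∈ s, G (p - q) := by
        refine Finset.sum_le_sum fun q _ => ?_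
        rw [norm_inner_tf_tf, ← map_sub]
        exact norm_inner_tf_gaussL2_le _
    _ = ∑ q ∈ s.map (Equiv.subLeft p).toEmbedding, G q := by simp
    _ ≤ ∑' q, G q := hsum.sum_le_tsum _ fun q _ => hG0 q

/-- The norm of the Feichtinger algebra. -/
def s0Norm (h : L2) : ℝ := ∫ w : ℝ × ℝ, ‖⟪tf w gaussL2, h⟫_ℂ‖

lemma s0Norm_nonneg (h : L2) : 0 ≤ s0Norm h := integral_nonneg fun _ => norm_nonneg _

lemma gaussL2_ne_zero : gaussL2 ≠ 0 := by
  intro h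
  have h1 : ∀ᵐ x : ℝ, ((Real.exp (-Real.pi * x ^ 2) : ℝ) : ℂ) = 0 := by
    filter_upwards [gaussL2_coeFn, Lp.coeFn_zero ℂ 2 (volume : Measure ℝ)] with x h1 h2
    rw [← h1, h, h2, Pi.zero_apply]
  obtain ⟨x, hx⟩ := h1.exists
  exact (Real.exp_pos _).ne' (Complex.ofReal_eq_zero.1 hx)

/-- Gabor systems over a lattice with window in the Feichtinger algebra are Bessel sequences,
with bound controlled by the norm of the window. -/
lemma exists_bessel_s0 {A : Matrix (Fin 2) (Fin 2) ℝ} (hA : A.det ≠ 0) :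
    ∃ K : ℝ, 0 ≤ K ∧ ∀ h : L2, InS0 h → ∀ (f : L2) (s : Finset (ℤ × ℤ)),
      ∑ p ∈ s, ‖⟪tf (latticeHom A p) h, f⟫_ℂ‖ ^ 2 ≤ (K * s0Norm h * ‖f‖) ^ 2 := by
  obtain ⟨K, hK0, hK⟩ := exists_bessel_gaussL2 hA
  have hcpos : 0 < ‖gaussL2‖ ^ 2 := by
    have := norm_pos_iff.2 gaussL2_ne_zero
    positivity
  set c := ‖gaussL2‖ ^ 2 with hc
  refine ⟨K / c, by positivity, fun h hh f s => ?_⟩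
  set d : ℤ × ℤ → ℂ := fun p => ⟪tf (latticeHom A p) h, f⟫_ℂ with hd
  set Q := ∑ p ∈ s, ‖d p‖ ^ 2 with hQ
  have hQ0 : 0 ≤ Q := Finset.sum_nonneg fun _ _ => by positivity
  have hrec : ∀ p, d p * c = ∫ w : ℝ × ℝ, ⟪h, tf w gaussL2⟫_ℂ *
      ⟪tf (latticeHom A p) (tf w gaussL2), f⟫_ℂ := by
    intro p
    have h1 := integral_inner_tf_mul (star (tfOp (latticeHom A p)) f) h gaussL2 gaussL2
    rw [ContinuousLinearMap.star_eq_adjoint, ContinuousLinearMap.adjoint_inner_right,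
      inner_self_eq_norm_sq_to_K] at h1
    simp_rw [ContinuousLinearMap.adjoint_inner_right, tfOp_apply] at h1
    simp_rw [mul_comm (⟪h, _⟫_ℂ)]
    rw [h1, hc]
    simp [hd]
  have hint : ∀ p, Integrable fun w : ℝ × ℝ => ⟪h, tf w gaussL2⟫_ℂ *
      ⟪tf (latticeHom A p) (tf w gaussL2), f⟫_ℂ := by
    intro p
    refine (integrable_inner_tf_mul (star (tfOp (latticeHom A p)) f) h gaussL2 gaussL2).congr
      (Eventually.of_forall fun w => ?_)
    simp only [ContinuousLinearMap.star_eq_adjoint, ContinuousLinearMap.adjoint_inner_right,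
      tfOp_apply]
    rw [mul_comm]
  have hQc : ((Q * c : ℝ) : ℂ) = ∫ w : ℝ × ℝ, ⟪h, tf w gaussL2⟫_ℂ *
      ⟪∑ p ∈ s, d p • tf (latticeHom A p) (tf w gaussL2), f⟫_ℂ := by
    have : ((Q * c : ℝ) : ℂ) = ∑ p ∈ s, conj (d p) * (d p * c) := by
      rw [hQ]
      push_cast
      rw [Finset.sum_mul]
      refine Finset.sum_congr rfl fun p _ => ?_
      rw [← Complex.conj_mul', mul_assoc]
    rw [this]
    simp_rw [hrec, ← integral_const_mul]
    rw [← integral_finsetSum _ fun p _ => (hint p).const_mul _]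
    refine integral_congr_ae (Eventually.of_forall fun w => ?_)
    simp only [sum_inner, inner_smul_left, Finset.mul_sum]
    refine Finset.sum_congr rfl fun p _ => ?_
    ring
  have hbound : ∀ w, ‖∑ p ∈ s, d p • tf (latticeHom A p) (tf w gaussL2)‖ ≤ K * √Q := by
    intro w
    have e : ∑ p ∈ s, d p • tf (latticeHom A p) (tf w gaussL2) = tf w (∑ p ∈ s,
        (d p * ech ((latticeHom A p).2 * w.1 - w.2 * (latticeHom A p).1)) •
          tf (latticeHom A p) gaussL2) := by
      have hs : ∀ F : ℤ × ℤ → L2, tf w (∑ p ∈ s, F p) = ∑ p ∈ s, tf w (F p) :=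
        fun F => map_sum (tfOp w) F s
      rw [hs]
      refine Finset.sum_congr rfl fun p _ => ?_
      rw [tf_smul, tf_tf, tf_tf, smul_smul, smul_smul, mul_assoc, ← ech_add, sub_add_cancel,
        add_comm w]
    rw [e, norm_tf]
    refine (hK s _).trans_eq ?_
    simp [hQ]
  have hle : Q * c ≤ s0Norm h * (K * √Q * ‖f‖) := by
    have h1 : Q * c = ‖((Q * c : ℝ) : ℂ)‖ := by
      rw [Complex.norm_real, Real.norm_of_nonneg (by positivity)]
    rw [h1, hQc, s0Norm, ← integral_mul_const]
    refine norm_integral_le_of_norm_le (hh.norm.mul_const _) (Eventually.of_forall fun w => ?_)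
    rw [norm_mul, norm_inner_symm]
    gcongr
    exact (norm_inner_le_norm _ _).trans (by gcongr; exact hbound w)
  have hsq : √Q ≤ K / c * s0Norm h * ‖f‖ := by
    rcases (Real.sqrt_nonneg Q).eq_or_lt with h0 | h0
    · rw [← h0]; have := s0Norm_nonneg h; positivity
    · have h2 : √Q * c ≤ s0Norm h * K * ‖f‖ := by
        refine le_of_mul_le_mul_right ?_ h0
        calc √Q * c * √Q = Q * c := by rw [mul_right_comm, Real.mul_self_sqrt hQ0]
          _ ≤ _ := hle
          _ = _ := by ring
      rw [div_mul_eq_mul_div, div_mul_eq_mul_div, le_div_iff₀ hcpos]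
      linarith
  calc Q = √Q ^ 2 := (Real.sq_sqrt hQ0).symm
    _ ≤ _ := by gcongr

lemma inS0_sub_tf {g : L2} (hg : InS0 g) (u : ℝ × ℝ) : InS0 (g - tf u g) := by
  have h1 : Integrable fun w : ℝ × ℝ => ⟪tf w gaussL2, tf u g⟫_ℂ := by
    refine (hg.comp_sub_right u).mono (continuous_inner_tf _ _).aestronglyMeasurable
      (Eventually.of_forall fun w => ?_)
    rw [norm_inner_tf_tf]
  unfold InS0
  simp_rw [inner_sub_right]
  exact Integrable.sub hg h1

/-- Time-frequency shifts act continuously in the norm of the Feichtinger algebra. -/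
lemma tendsto_s0Norm_sub_tf {g : L2} (hg : InS0 g) :
    Tendsto (fun u => s0Norm (g - tf u g)) (nhds 0) (nhds 0) := by
  have hshift : ∀ u : ℝ × ℝ, ∫ w, ‖⟪tf w gaussL2, tf u g⟫_ℂ‖ = s0Norm g := by
    intro u
    simp_rw [norm_inner_tf_tf]
    exact integral_sub_right_eq_self (fun w => ‖⟪tf w gaussL2, g⟫_ℂ‖) u
  have hint : ∀ u : ℝ × ℝ, Integrable fun w : ℝ × ℝ => ‖⟪tf w gaussL2, tf u g⟫_ℂ‖ := by
    intro u
    simp_rw [norm_inner_tf_tf]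
    exact (hg.comp_sub_right u).norm
  have hdct : Tendsto (fun u : ℝ × ℝ => ∫ w, (‖⟪tf w gaussL2, g - tf u g⟫_ℂ‖
      - ‖⟪tf w gaussL2, tf u g⟫_ℂ‖)) (nhds 0) (nhds (∫ w, -‖⟪tf w gaussL2, g⟫_ℂ‖)) := by
    refine tendsto_integral_filter_of_dominated_convergence
      (fun w => ‖⟪tf w gaussL2, g⟫_ℂ‖) ?_ ?_ hg.norm ?_
    · exact Eventually.of_forall fun u => ((continuous_inner_tf _ _).norm.sub
        (continuous_inner_tf _ _).norm).aestronglyMeasurable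
    · refine Eventually.of_forall fun u => Eventually.of_forall fun w => ?_
      rw [inner_sub_right, ← norm_neg (⟪tf w gaussL2, tf u g⟫_ℂ), Real.norm_eq_abs]
      refine (abs_norm_sub_norm_le _ _).trans ?_
      rw [sub_neg_eq_add, sub_add_cancel]
    · refine Eventually.of_forall fun w => ?_
      have hc : Continuous fun u : ℝ × ℝ => ‖⟪tf w gaussL2, g - tf u g⟫_ℂ‖
          - ‖⟪tf w gaussL2, tf u g⟫_ℂ‖ :=
        (continuous_const.inner (continuous_const.sub (continuous_tf g))).norm.sub
          (continuous_const.inner (continuous_tf g)).norm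
      have := hc.tendsto 0
      simpa [tf_zero] using this
  have h := hdct.add_const (s0Norm g)
  rw [integral_neg, show -(∫ w, ‖⟪tf w gaussL2, g⟫_ℂ‖) + s0Norm g = 0 from neg_add_cancel _] at h
  refine h.congr fun u => ?_
  rw [integral_sub (inS0_sub_tf hg u).norm (hint u), hshift, sub_add_cancel]
  rfl

lemma star_conjTf (w : ℝ × ℝ) (X : L2 →L[ℂ] L2) : star (conjTf w X) = conjTf w (star X) := by
  simp [conjTf, mul_assoc]

lemma conjTf_zero (X : L2 →L[ℂ] L2) : conjTf 0 X = X := by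
  simp [conjTf, tfOp_zero]

lemma conjTf_one (w : ℝ × ℝ) : conjTf w 1 = 1 := by
  simp [conjTf, tfOp_mul_star]

lemma norm_apply_le_of_isStarProjection {P : L2 →L[ℂ] L2} (hP : IsStarProjection P) (f : L2) :
    ‖P f‖ ≤ ‖f‖ := by
  obtain ⟨K, hK, rfl⟩ := (isStarProjection_iff_eq_starProjection).1 hP
  exact K.norm_starProjection_apply_le f

lemma isStarProjection_conjTf {P : L2 →L[ℂ] L2} (hP : IsStarProjection P) (w : ℝ × ℝ) :
    IsStarProjection (conjTf w P) where
  isIdempotentElem := by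
    rw [IsIdempotentElem, ← conjTf_mul, hP.isIdempotentElem.eq]
  isSelfAdjoint := by
    rw [IsSelfAdjoint, star_conjTf, hP.isSelfAdjoint.star_eq]

lemma inner_apply_left_of_isStarProjection {P : L2 →L[ℂ] L2} (hP : IsStarProjection P)
    (f h : L2) : ⟪P f, h⟫_ℂ = ⟪f, P h⟫_ℂ := by
  rw [← ContinuousLinearMap.adjoint_inner_left, ← ContinuousLinearMap.star_eq_adjoint,
    hP.isSelfAdjoint.star_eq]

section Continuity

variable {g : L2} {A : Matrix (Fin 2) (Fin 2) ℝ} {P : L2 →L[ℂ] L2} {a K : ℝ}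

lemma norm_mul_one_sub_conjTf_le (hg : InS0 g) (ha : 0 < a) (hP : IsStarProjection P)
    (hPg : ∀ p, P (tf (latticeHom A p) g) = tf (latticeHom A p) g)
    (hframe : ∀ f, a * ‖P f‖ ^ 2 ≤ ∑' p, ‖⟪tf (latticeHom A p) g, P f⟫_ℂ‖ ^ 2)
    (hK0 : 0 ≤ K)
    (hK : ∀ h : L2, InS0 h → ∀ (f : L2) (s : Finset (ℤ × ℤ)),
      ∑ p ∈ s, ‖⟪tf (latticeHom A p) h, f⟫_ℂ‖ ^ 2 ≤ (K * s0Norm h * ‖f‖) ^ 2) (w : ℝ × ℝ) :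
    ‖P * (1 - conjTf w P)‖ ≤ K * s0Norm (g - tf w g) / √a := by
  have hs0 := s0Norm_nonneg (g - tf w g)
  refine ContinuousLinearMap.opNorm_le_bound _ (by positivity) fun f => ?_
  set f' := (1 - conjTf w P) f with hf'
  have hPw := isStarProjection_conjTf hP w
  have hQw : IsStarProjection (1 - conjTf w P) := hPw.one_sub
  have hf'le : ‖f'‖ ≤ ‖f‖ := norm_apply_le_of_isStarProjection hQw f
  have horth : ∀ p, ⟪tf (latticeHom A p) (tf w g), f'⟫_ℂ = 0 := by
    intro p
    have e : tf (latticeHom A p) (tf w g) =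
        ech ((latticeHom A p).2 * w.1 - w.2 * (latticeHom A p).1) •
          tf w (tf (latticeHom A p) g) := by
      rw [tf_tf, tf_tf, smul_smul, ← ech_add, sub_add_cancel, add_comm w]
    have e2 : (1 - conjTf w P) (tf w (tf (latticeHom A p) g)) = 0 := by
      have : star (tfOp w) (tf w (tf (latticeHom A p) g)) = tf (latticeHom A p) g :=
        congrArg (fun X => X (tf (latticeHom A p) g)) (star_tfOp_mul w)
      simp [conjTf, this, hPg]
    rw [e, inner_smul_left, hf', ← inner_apply_left_of_isStarProjection hQw, e2, inner_zero_left,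
      mul_zero]
  have hterm : ∀ p, ⟪tf (latticeHom A p) g, P f'⟫_ℂ = ⟪tf (latticeHom A p) (g - tf w g), f'⟫_ℂ := by
    intro p
    have e : tf (latticeHom A p) (g - tf w g) =
        tf (latticeHom A p) g - tf (latticeHom A p) (tf w g) :=
      map_sub (tfOp (latticeHom A p)) g (tf w g)
    rw [← inner_apply_left_of_isStarProjection hP, hPg, e, inner_sub_left, horth, sub_zero]
  have h1 : a * ‖P f'‖ ^ 2 ≤ (K * s0Norm (g - tf w g) * ‖f'‖) ^ 2 := by
    refine (hframe f').trans ?_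
    simp_rw [hterm]
    exact Real.tsum_le_of_sum_le (fun _ => by positivity) fun s =>
      hK _ (inS0_sub_tf hg w) f' s
  have h2 : √a * ‖P f'‖ ≤ K * s0Norm (g - tf w g) * ‖f‖ := by
    refine le_trans (abs_le_of_sq_le_sq' ?_ (by positivity)).2
      (mul_le_mul_of_nonneg_left hf'le (by positivity))
    rw [mul_pow, Real.sq_sqrt ha.le]
    exact h1
  rw [div_mul_eq_mul_div, le_div_iff₀ (Real.sqrt_pos.2 ha), mul_comm]
  exact h2

lemma continuous_conjTf (hg : InS0 g) (ha : 0 < a) (hP : IsStarProjection P)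
    (hPg : ∀ p, P (tf (latticeHom A p) g) = tf (latticeHom A p) g)
    (hframe : ∀ f, a * ‖P f‖ ^ 2 ≤ ∑' p, ‖⟪tf (latticeHom A p) g, P f⟫_ℂ‖ ^ 2)
    (hA : A.det ≠ 0) : Continuous fun w => conjTf w P := by
  obtain ⟨K, hK0, hK⟩ := exists_bessel_s0 hA
  have hle := norm_mul_one_sub_conjTf_le hg ha hP hPg hframe hK0 hK
  have h0 : Tendsto (fun w => ‖conjTf w P - P‖) (nhds 0) (nhds 0) := by
    have hlim : Tendsto (fun w : ℝ × ℝ => K * s0Norm (g - tf w g) / √a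
        + K * s0Norm (g - tf (-w) g) / √a) (nhds 0) (nhds 0) := by
      have h1 := ((tendsto_s0Norm_sub_tf hg).const_mul K).div_const (√a)
      have hneg : Tendsto (fun w : ℝ × ℝ => -w) (nhds 0) (nhds 0) := by
        simpa using (continuous_neg (G := ℝ × ℝ)).tendsto 0
      simpa using h1.add (h1.comp hneg)
    refine squeeze_zero (fun _ => norm_nonneg _) (fun w => ?_) hlim
    have e : conjTf w P - P = (1 - P) * conjTf w P - P * (1 - conjTf w P) := by
      noncomm_ring
    have e2 : (1 - P) * conjTf w P = conjTf w (star (P * (1 - conjTf (-w) P))) := by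
      rw [star_mul, (isStarProjection_conjTf hP (-w)).one_sub.isSelfAdjoint.star_eq,
        hP.isSelfAdjoint.star_eq, conjTf_mul, conjTf_sub, conjTf_one, ← conjTf_add,
        add_neg_cancel, conjTf_zero]
    have e3 : ‖(1 - P) * conjTf w P‖ ≤ K * s0Norm (g - tf (-w) g) / √a := by
      rw [e2]
      refine (norm_conjTf_le _ _).trans ?_
      rw [ContinuousLinearMap.star_eq_adjoint, LinearIsometryEquiv.norm_map]
      exact hle (-w)
    rw [e]
    refine (norm_sub_le _ _).trans ?_
    linarith [hle w]
  rw [continuous_iff_continuousAt]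
  intro v
  rw [ContinuousAt, tendsto_iff_norm_sub_tendsto_zero]
  have hsub : Tendsto (fun w : ℝ × ℝ => w - v) (nhds v) (nhds 0) := by
    simpa using (continuous_id.sub continuous_const).tendsto (f := fun w : ℝ × ℝ => w - v) v
  refine squeeze_zero (fun _ => norm_nonneg _) (fun w => ?_) (h0.comp hsub)
  have e : conjTf w P - conjTf v P = conjTf v (conjTf (w - v) P - P) := by
    rw [conjTf_sub, ← conjTf_add, add_sub_cancel]
  rw [e]
  exact norm_conjTf_le _ _

end Continuity

lemma eq_zero_of_forall_integral_ech_eq_zero {ψ : ℝ → ℂ} (hc : Continuous ψ)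
    (hp : Function.Periodic ψ 1)
    (h : ∀ n : ℤ, ∫ s in (0 : ℝ)..1, ech (-(n * s)) * ψ s = 0) (s : ℝ) : ψ s = 0 := by
  have : Fact ((0 : ℝ) < 1) := ⟨one_pos⟩
  let f : C(AddCircle (1 : ℝ), ℂ) :=
    ⟨hp.lift, continuous_coinduced_dom.2 hc⟩
  have hf : ∀ x : ℝ, f (x : AddCircle (1 : ℝ)) = ψ x := fun x => hp.lift_coe x
  have hcoeff : fourierCoeff f = 0 := by
    funext n
    rw [fourierCoeff_eq_intervalIntegral f n 0, Pi.zero_apply]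
    have : ∫ x in (0 : ℝ)..0 + 1, fourier (-n) (x : AddCircle (1 : ℝ)) • f x = 0 := by
      rw [zero_add, ← h n]
      refine intervalIntegral.integral_congr fun x _ => ?_
      simp only [hf, fourier_coe_apply, smul_eq_mul, ech]
      congr 2
      push_cast
      ring
    rw [this, smul_zero]
  have hsum := has_pointwise_sum_fourier_series_of_summable (f := f)
    (by rw [hcoeff]; exact summable_zero) (s : AddCircle (1 : ℝ))
  rw [hcoeff] at hsum
  simp only [Pi.zero_apply, zero_smul] at hsum
  rw [← hf]
  exact hsum.unique hasSum_zero

/-- Conjugation by a time-frequency shift as a bounded linear map on operators. -/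
def conjTfL (w : ℝ × ℝ) : (L2 →L[ℂ] L2) →L[ℂ] (L2 →L[ℂ] L2) :=
  LinearMap.mkContinuous
    { toFun := conjTf w
      map_add' := fun X Y => by simp [conjTf, mul_add, add_mul]
      map_smul' := fun c X => conjTf_smul w c X } 1
    fun X => (norm_conjTf_le w X).trans_eq (one_mul _).symm

lemma conjTfL_apply (w : ℝ × ℝ) (X : L2 →L[ℂ] L2) : conjTfL w X = conjTf w X := rfl

lemma exists_eq_smul_add_smul {z l : ℝ × ℝ} (hδ : l.2 * z.1 - z.2 * l.1 ≠ 0) (w : ℝ × ℝ) :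
    ∃ t u : ℝ, w = t • z + u • l := by
  generalize hd : l.2 * z.1 - z.2 * l.1 = δ at hδ
  refine ⟨(l.2 * w.1 - w.2 * l.1) / δ, (w.2 * z.1 - z.2 * w.1) / δ, ?_⟩
  ext
  · simp only [Prod.fst_add, Prod.smul_fst, smul_eq_mul]
    field_simp
    rw [← hd]; ring
  · simp only [Prod.snd_add, Prod.smul_snd, smul_eq_mul]
    field_simp
    rw [← hd]; ring

lemma commute_smul_conjTf {P : L2 →L[ℂ] L2} {z l : ℝ × ℝ}
    (hz : ∀ t : ℝ, conjTf (t • z) P = P) (hl : conjTf l P = P)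
    (hδ : l.2 * z.1 - z.2 * l.1 ≠ 0) (hc : Continuous fun w => conjTf w P) (s u : ℝ) :
    conjTf (s • l) P * conjTf (u • l) P = conjTf (u • l) P * conjTf (s • l) P := by
  set δ := l.2 * z.1 - z.2 * l.1 with hδdef
  set F : ℝ → (L2 →L[ℂ] L2) := fun s => conjTf (s • l) P with hF
  have hFc : Continuous F := hc.comp (by fun_prop)
  have hFp : Function.Periodic F 1 := fun s => by
    simp only [hF, add_smul, one_smul, conjTf_add, hl]
  have hFadd : ∀ u s, conjTf (u • l) (F s) = F (u + s) := fun u s => by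
    simp only [hF, add_smul, conjTf_add]
  have hFz : ∀ t s : ℝ, conjTf (t • z) (F s) = F s := fun t s => by
    simp only [hF]
    rw [← conjTf_add, add_comm, conjTf_add, hz]
  set C : ℤ → (L2 →L[ℂ] L2) := fun n => ∫ s in (0 : ℝ)..1, ech (-(n * s)) • F s with hC
  have hint : ∀ n : ℤ, Continuous fun s : ℝ => ech (-(n * s)) • F s := fun n => by fun_prop
  have hCconj : ∀ n w, conjTf w (C n) =
      ∫ s in (0 : ℝ)..1, ech (-(n * s)) • conjTf w (F s) := fun n w => by
    rw [← conjTfL_apply, hC,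
      ← ContinuousLinearMap.intervalIntegral_comp_comm _ ((hint n).intervalIntegrable 0 1)]
    simp only [map_smul, conjTfL_apply]
  have hCz : ∀ (n : ℤ) (t : ℝ), conjTf (t • z) (C n) = C n := fun n t => by
    rw [hCconj]; simp only [hFz, hC]
  have hCl : ∀ (n : ℤ) (u : ℝ), conjTf (u • l) (C n) = ech (n * u) • C n := fun n u => by
    have hper : Function.Periodic (fun s : ℝ => ech (-(n * s)) • F s) 1 := fun s => by
      have : ech (-(n : ℝ)) = 1 := by
        rw [ech, Complex.exp_eq_one_iff]
        exact ⟨-n, by push_cast; ring⟩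
      simp only [hFp s, mul_add, mul_one, neg_add, ech_add, this]
    rw [hCconj]
    have e : ∀ s : ℝ, ech (-(n * s)) • conjTf (u • l) (F s) =
        ech (n * u) • (ech (-(n * (s + u))) • F (s + u)) := fun s => by
      rw [hFadd, smul_smul, ← ech_add, add_comm u s]
      congr 2
      ring
    simp only [e]
    rw [intervalIntegral.integral_smul,
      intervalIntegral.integral_comp_add_right (fun s : ℝ => ech (-(n * s)) • F s),
      zero_add, add_comm 1 u, hper.intervalIntegral_add_eq u 0, zero_add]
  have hCscalar : ∀ n : ℤ, ∃ c : ℂ, C n = c • tfOp ((n / δ) • z) := fun n => by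
    set m : ℝ × ℝ := ((n : ℝ) / δ) • z with hm
    have hYz : ∀ t : ℝ, conjTf (t • z) (C n * star (tfOp m)) = C n * star (tfOp m) := fun t => by
      rw [conjTf_mul, hCz, ← star_conjTf, conjTf_tfOp]
      have : (t • z).2 * m.1 - m.2 * (t • z).1 = 0 := by simp [hm]; ring
      rw [this, ech_zero, one_smul]
    have hYl : ∀ u : ℝ, conjTf (u • l) (C n * star (tfOp m)) = C n * star (tfOp m) := fun u => by
      rw [conjTf_mul, hCl, ← star_conjTf, conjTf_tfOp]
      have : (u • l).2 * m.1 - m.2 * (u • l).1 = n * u := by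
        simp only [hm, Prod.smul_fst, Prod.smul_snd, smul_eq_mul]
        field_simp
        rw [hδdef]
      rw [this, star_smul, smul_mul_smul_comm, ← starRingEnd_apply, conj_ech, ech_mul_ech_neg,
        one_smul]
    obtain ⟨c, hcY⟩ := exists_smul_of_commute_tfOp (X := C n * star (tfOp m)) fun w => by
      obtain ⟨t, u, rfl⟩ := exists_eq_smul_add_smul hδ w
      rw [← conjTf_eq_self_iff, conjTf_add, hYl, hYz]
    refine ⟨c, ?_⟩
    calc C n = C n * star (tfOp m) * tfOp m := by rw [mul_assoc, star_tfOp_mul, mul_one]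
      _ = c • tfOp m := by rw [hcY, smul_mul_assoc, one_mul]
  have hCcomm : ∀ (n : ℤ) (u : ℝ), C n * F u = F u * C n := fun n u => by
    obtain ⟨c, hcn⟩ := hCscalar n
    rw [hcn, smul_mul_assoc, mul_smul_comm, (conjTf_eq_self_iff _ _).1 (hFz _ u)]
  change F s * F u = F u * F s
  refine ContinuousLinearMap.ext fun f => ext_inner_left ℂ fun k => sub_eq_zero.1 ?_
  let ℓ : (L2 →L[ℂ] L2) →L[ℂ] ℂ := (innerSL ℂ k).comp
    ((ContinuousLinearMap.apply ℂ L2 f).comp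
      ((ContinuousLinearMap.mul ℂ (L2 →L[ℂ] L2)).flip (F u)
        - ContinuousLinearMap.mul ℂ (L2 →L[ℂ] L2) (F u)))
  have hℓ : ∀ X, ℓ X = ⟪k, (X * F u) f⟫_ℂ - ⟪k, (F u * X) f⟫_ℂ := fun X => by
    simp [ℓ]
  rw [← hℓ]
  refine eq_zero_of_forall_integral_ech_eq_zero (ψ := fun s => ℓ (F s)) (ℓ.continuous.comp hFc)
    (fun s => by simp only [hFp s]) (fun n => ?_) s
  have : ∫ s in (0 : ℝ)..1, ech (-(n * s)) * ℓ (F s) = ℓ (C n) := by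
    rw [hC, ← ContinuousLinearMap.intervalIntegral_comp_comm _
      ((hint n).intervalIntegrable 0 1)]
    simp only [map_smul, smul_eq_mul]
  rw [this, hℓ, hCcomm, sub_self]

lemma eq_of_commute_of_norm_sub_lt_one {R : Type*} [NormedRing R] {p q : R} (hp : p * p = p)
    (hq : q * q = q) (hpq : p * q = q * p) (h : ‖p - q‖ < 1) : p = q := by
  have hcube : (p - q) * (p - q) * (p - q) = p - q := by
    have h1 : p * q * p = p * q := by rw [mul_assoc, ← hpq, ← mul_assoc, hp]
    have h2 : p * q * q = p * q := by rw [mul_assoc, hq]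
    have h3 : (p - q) * (p - q) = p + q - p * q - p * q := by
      rw [sub_mul, mul_sub, mul_sub, hp, hq, ← hpq]; abel
    rw [h3]
    simp only [sub_mul, add_mul, mul_sub, hp, hq, h1, h2, ← hpq]
    abel
  by_contra hne
  have hpos : 0 < ‖p - q‖ := norm_pos_iff.2 (sub_ne_zero.2 hne)
  have hle : ‖p - q‖ ≤ ‖p - q‖ * ‖p - q‖ * ‖p - q‖ := by
    calc ‖p - q‖ = ‖(p - q) * (p - q) * (p - q)‖ := by rw [hcube]
      _ ≤ _ := (norm_mul_le _ _).trans (by gcongr; exact norm_mul_le _ _)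
  nlinarith [mul_pos hpos hpos]

lemma exists_smul_of_invariant_line {P : L2 →L[ℂ] L2} {z l : ℝ × ℝ} (hP : P * P = P)
    (hz : ∀ t : ℝ, conjTf (t • z) P = P) (hl : conjTf l P = P)
    (hδ : l.2 * z.1 - z.2 * l.1 ≠ 0) (hc : Continuous fun w => conjTf w P) :
    ∃ c : ℂ, P = c • 1 := by
  have hidem : ∀ s : ℝ, conjTf (s • l) P * conjTf (s • l) P = conjTf (s • l) P := fun s => by
    rw [← conjTf_mul, hP]
  have hFc : Continuous fun s : ℝ => conjTf (s • l) P := hc.comp (by fun_prop)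
  have hloc : IsLocallyConstant fun s : ℝ => conjTf (s • l) P := by
    rw [IsLocallyConstant.iff_eventually_eq]
    intro u
    filter_upwards [Metric.continuous_iff'.1 hFc u 1 one_pos] with s hs
    rw [dist_eq_norm] at hs
    exact eq_of_commute_of_norm_sub_lt_one (hidem s) (hidem u)
      (commute_smul_conjTf hz hl hδ hc s u) hs
  have hlu : ∀ u : ℝ, conjTf (u • l) P = P := fun u => by
    have := hloc.apply_eq_of_isPreconnected isPreconnected_univ (Set.mem_univ u)
      (Set.mem_univ (0 : ℝ))
    simpa only [zero_smul, conjTf_zero] using this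
  refine exists_smul_of_commute_tfOp fun w => (conjTf_eq_self_iff w P).1 ?_
  obtain ⟨t, u, rfl⟩ := exists_eq_smul_add_smul hδ w
  rw [conjTf_add, hlu, hz]

lemma tfOp_mul_starProjection {G : Submodule ℂ L2} [G.HasOrthogonalProjection] {w : ℝ × ℝ}
    (hw : ∀ f ∈ G, tf w f ∈ G) (hw' : ∀ f ∈ G, tf (-w) f ∈ G) :
    tfOp w * G.starProjection = G.starProjection * tfOp w := by
  ext1 f
  refine (Submodule.eq_starProjection_of_mem_of_inner_eq_zero
    (hw _ (G.starProjection_apply_mem f)) fun k hk => ?_).symm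
  have hstar : star (tfOp w) k ∈ G := by
    rw [star_tfOp]
    exact G.smul_mem _ (hw' k hk)
  have e : tf w f - tf w (G.starProjection f) = tfOp w (f - G.starProjection f) := by
    rw [map_sub]; rfl
  change ⟪tf w f - tf w (G.starProjection f), k⟫_ℂ = 0
  rw [e, ← ContinuousLinearMap.adjoint_inner_right, ← ContinuousLinearMap.star_eq_adjoint]
  exact G.starProjection_inner_eq_zero f _ hstar

lemma tf_mem_topologicalClosure_span {g : L2} {A : Matrix (Fin 2) (Fin 2) ℝ} (p : ℤ × ℤ) {f : L2}
    (hf : f ∈ (Submodule.span ℂ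
      (Set.range fun q => tf (latticeHom A q) g)).topologicalClosure) :
    tf (latticeHom A p) f ∈ (Submodule.span ℂ
      (Set.range fun q => tf (latticeHom A q) g)).topologicalClosure := by
  have hmaps : Set.MapsTo (tfOp (latticeHom A p))
      (Submodule.span ℂ (Set.range fun q => tf (latticeHom A q) g))
      (Submodule.span ℂ (Set.range fun q => tf (latticeHom A q) g)) := by
    intro k hk
    refine Submodule.span_le (p := (Submodule.span ℂ
      (Set.range fun q => tf (latticeHom A q) g)).comap (tfOp (latticeHom A p)).toLinearMap)
      |>.2 ?_ hk
    rintro _ ⟨q, rfl⟩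
    simp only [SetLike.mem_coe, Submodule.mem_comap, ContinuousLinearMap.coe_coe, tfOp_apply,
      tf_tf, ← map_add]
    exact Submodule.smul_mem _ _ (Submodule.subset_span ⟨p + q, rfl⟩)
  exact hmaps.closure (tfOp (latticeHom A p)).continuous hf

/-- if `𝔍(𝒢)` contains a full line through the origin, then
`𝒢 = L²(ℝ)`. -/
theorem statement_5 (g : L2) (hg : InS0 g) (hg0 : g ≠ 0)
    (Λ : Set (ℝ × ℝ)) (hΛ : IsLattice Λ) (hframe : IsFrameSeq g Λ)
    (z : ℝ × ℝ) (hz : z ≠ 0)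
    (hline : {p : ℝ × ℝ | ∃ t : ℝ, p = t • z} ⊆ stab (gaborSpan g Λ)) :
    gaborSpan g Λ = Set.univ := by
  obtain ⟨A, hdet, hΛA⟩ := hΛ
  have hA : A.det ≠ 0 := hdet.ne_zero
  have hrange : Λ = Set.range (latticeHom A) := by
    rw [hΛA]
    ext p
    constructor
    · rintro ⟨k, l, rfl⟩
      exact ⟨(k, l), rfl⟩
    · rintro ⟨⟨k, l⟩, rfl⟩
      exact ⟨k, l, rfl⟩
  subst hrange
  set G : Submodule ℂ L2 := (Submodule.span ℂ
    (Set.range fun q => tf (latticeHom A q) g)).topologicalClosure with hG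
  have hGspan : gaborSpan g (Set.range (latticeHom A)) = G := by
    rw [gaborSpan, ← Set.range_comp]
    rfl
  rw [hGspan] at hline ⊢
  have : CompleteSpace G := Submodule.isClosed_topologicalClosure _ |>.completeSpace_coe
  have hinv : ∀ p, conjTf (latticeHom A p) G.starProjection = G.starProjection := fun p =>
    (conjTf_eq_self_iff _ _).2 <| tfOp_mul_starProjection
      (fun f hf => tf_mem_topologicalClosure_span p hf) fun f hf => by
        rw [← map_neg]; exact tf_mem_topologicalClosure_span (-p) hf
  have hinvz : ∀ t : ℝ, conjTf (t • z) G.starProjection = G.starProjection := fun t =>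
    (conjTf_eq_self_iff _ _).2 <| tfOp_mul_starProjection (hline ⟨t, rfl⟩)
      (hline ⟨-t, (neg_smul t z).symm⟩)
  have hmem : ∀ p, tf (latticeHom A p) g ∈ G := fun p =>
    Submodule.le_topologicalClosure _ (Submodule.subset_span ⟨p, rfl⟩)
  have hcont : Continuous fun w => conjTf w G.starProjection := by
    obtain ⟨a, _, ha, -, hbound⟩ := hframe
    refine continuous_conjTf hg ha isStarProjection_starProjection
      (fun p => Submodule.starProjection_eq_self_iff.2 (hmem p)) (fun f => ?_) hA
    refine ((hbound (G.starProjection f)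
      (hGspan ▸ G.starProjection_apply_mem f)).1).trans_eq ?_
    exact ((Equiv.ofInjective _ (latticeHom_injective hA)).tsum_eq
      fun lam : Set.range (latticeHom A) => ‖⟪tf lam g, G.starProjection f⟫_ℂ‖ ^ 2).symm
  obtain ⟨p, hp⟩ : ∃ p, (latticeHom A p).2 * z.1 - z.2 * (latticeHom A p).1 ≠ 0 := by
    by_contra! h
    have h1 := h (1, 0)
    have h2 := h (0, 1)
    simp only [latticeHom, AddMonoidHom.coe_mk, ZeroHom.coe_mk, Int.cast_one, Int.cast_zero,
      mul_one, mul_zero, add_zero, zero_add] at h1 h2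
    refine hz (Prod.ext ?_ ?_) <;> refine (mul_eq_zero.1 ?_).resolve_left hA <;>
      rw [Matrix.det_fin_two]
    · linear_combination A 0 0 * h2 - A 0 1 * h1
    · linear_combination A 1 0 * h2 - A 1 1 * h1
  obtain ⟨c, hc⟩ := exists_smul_of_invariant_line
    isStarProjection_starProjection.isIdempotentElem hinvz (hinv p) hp hcont
  have hgG : g ∈ G := by simpa [tf_zero] using hmem 0
  have hc0 : c ≠ 0 := by
    rintro rfl
    refine hg0 ?_
    rw [← Submodule.starProjection_eq_self_iff.2 hgG, hc, zero_smul]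
    rfl
  refine Set.eq_univ_of_forall fun f => ?_
  have hf : c • f ∈ G := by
    have := G.starProjection_apply_mem f
    rwa [hc] at this
  exact (G.smul_mem_iff hc0).1 hf

end
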